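/- Let I = [s,t] ⊆ ℝ/ℤ be an R-interval and let (c₁, c₂) be an ordering of the two colors {red, blue}. Then there exist points x₁, x₂ with s, x₁, x₂, t in positive order along I such that [s,x₁], [x₁,x₂], [x₂,t] are R-intervals whose union is I, and x_i has color c_i for i = 1, 2. -/

import Mathlib

noncomputable section

open Set

/-- The circle `ℝ/ℤ`. -/
abbrev 𝕊 : Type := AddCircle (1 : ℝ)

/-- The natural projection from `ℝ` to the circle `ℝ/ℤ`. -/
def tc (x : ℝ) : 𝕊 := (x : 𝕊)

/-- The closed arc on the circle from `a` to `b`, traversed in the positive direction;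
arcs are parametrized by real lifts `a ≤ b ≤ a + 1` of their endpoints. -/
def cArc (a b : ℝ) : Set 𝕊 := tc '' Set.Icc a b

/-- The open arc on the circle from `a` to `b` (the interior of `cArc a b`). -/
def oArc (a b : ℝ) : Set 𝕊 := tc '' Set.Ioo a b

/-- The multiplication-by-`d` map `σ_d : ℝ/ℤ → ℝ/ℤ`, `σ_d t = d·t`. -/
def sigmaC (d : ℕ) (x : 𝕊) : 𝕊 := d • x

/-- The three model arcs `(0,1)` (type A), `(0,2/3)` (type B), `(1/3,1)` (type C) of
R-intervals, given by the pairs of endpoints. -/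
def rTypes : Set (ℝ × ℝ) := {(0, 1), (0, 2/3), (1/3, 1)}

/-- The arc `[a,b]` is an R-interval of type `J` with blow-up exponent `n`: the map `σ₃^n`
restricts to a homeomorphism from the open arc `(a,b)` onto the open model arc `J`. -/
def RIntervalWith (a b : ℝ) (J : ℝ × ℝ) (n : ℕ) : Prop :=
  a < b ∧ b ≤ a + 1 ∧ J ∈ rTypes ∧
    ∃ e : ↥(oArc a b) ≃ₜ ↥(oArc J.1 J.2),
      ∀ x : ↥(oArc a b), (e x : 𝕊) = (sigmaC 3)^[n] ↑x

/-- The arc `[a,b]` is an R-interval. -/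
def IsRInterval (a b : ℝ) : Prop := ∃ J n, RIntervalWith a b J n

/-- A point of the circle is colored red if its reduced form is `p/3^k` with `k ≥ 1` and
`p ≡ 1 (mod 3)`. -/
def RedT (x : 𝕊) : Prop :=
  ∃ (p : ℤ) (k : ℕ), 1 ≤ k ∧ p % 3 = 1 ∧ x = tc ((p : ℝ) / 3 ^ k)

/-- A point of the circle is colored blue if it is `0`, or if its reduced form is `p/3^k`
with `k ≥ 1` and `p ≡ 2 (mod 3)`. -/
def BlueT (x : 𝕊) : Prop :=
  x = 0 ∨ ∃ (p : ℤ) (k : ℕ), 1 ≤ k ∧ p % 3 = 2 ∧ x = tc ((p : ℝ) / 3 ^ k)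

/-- The two colors. -/
inductive TColor : Type
  | red : TColor
  | blue : TColor

/-- A point of the circle has a given color. -/
def HasTColor : TColor → 𝕊 → Prop
  | TColor.red => RedT
  | TColor.blue => BlueT

theorem tc_eq_tc_iff {x y : ℝ} : tc x = tc y ↔ ∃ m : ℤ, y = x + m := by
  unfold tc
  rw [← sub_eq_zero, ← AddCircle.coe_sub, AddCircle.coe_eq_zero_iff]
  constructor
  · rintro ⟨m, hm⟩
    refine ⟨-m, ?_⟩
    simp only [zsmul_eq_mul, mul_one] at hm
    push_cast
    linarith
  · rintro ⟨m, rfl⟩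
    exact ⟨-m, by simp⟩

theorem sigmaC_iterate_tc (d n : ℕ) (x : ℝ) : (sigmaC d)^[n] (tc x) = tc ((d : ℝ) ^ n * x) := by
  induction n generalizing x with
  | zero => simp
  | succ n ih =>
    have hstep : sigmaC d (tc x) = tc (d * x) := by
      simp only [sigmaC, tc, ← AddCircle.coe_nsmul, nsmul_eq_mul]
    rw [Function.iterate_succ_apply, hstep, ih]
    congr 1
    ring

theorem tc_injOn_Ioo {a b : ℝ} (hab : b ≤ a + 1) : InjOn tc (Ioo a b) := by
  intro x hx y hy hxy
  obtain ⟨m, rfl⟩ := tc_eq_tc_iff.1 hxy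
  have h1 : (m : ℝ) < 1 := by linarith [hx.1, hy.2]
  have h2 : (-1 : ℝ) < m := by linarith [hx.2, hy.1]
  have h3 : m < 1 := by exact_mod_cast h1
  have h4 : -1 < m := by exact_mod_cast h2
  obtain rfl : m = 0 := by omega
  simp

/-- An open interval of length at most one is homeomorphic to its image in the circle. -/
def oArcHomeomorph {a b : ℝ} (hab : b ≤ a + 1) : Ioo a b ≃ₜ oArc a b :=
  have hemb : Topology.IsOpenEmbedding (fun x : Ioo a b => tc x) :=
    .of_continuous_injective_isOpenMap
      ((AddCircle.continuous_mk' 1).comp continuous_subtype_val)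
      (injOn_iff_injective.1 (tc_injOn_Ioo hab))
      (QuotientAddGroup.isOpenMap_coe.comp isOpen_Ioo.isOpenMap_subtype_val)
  hemb.isEmbedding.toHomeomorph.trans
    (Homeomorph.setCongr (by rw [oArc, image_eq_range]))

theorem coe_oArcHomeomorph {a b : ℝ} (hab : b ≤ a + 1) (x : Ioo a b) :
    (oArcHomeomorph hab x : 𝕊) = tc x := rfl

theorem tc_left_notMem_oArc {a b : ℝ} (hab : b ≤ a + 1) : tc a ∉ oArc a b := by
  rintro ⟨z, hz, hza⟩
  obtain ⟨m, hm⟩ := tc_eq_tc_iff.1 hza.symm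
  have h1 : (0 : ℝ) < m := by linarith [hz.1]
  have h2 : (m : ℝ) < 1 := by linarith [hz.2]
  have h3 : 0 < m := by exact_mod_cast h1
  have h4 : m < 1 := by exact_mod_cast h2
  omega

theorem tc_right_notMem_oArc {a b : ℝ} (hab : b ≤ a + 1) : tc b ∉ oArc a b := by
  rintro ⟨z, hz, hzb⟩
  obtain ⟨m, hm⟩ := tc_eq_tc_iff.1 hzb
  have h1 : (0 : ℝ) < m := by linarith [hz.2]
  have h2 : (m : ℝ) < 1 := by linarith [hz.1]
  have h3 : 0 < m := by exact_mod_cast h1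
  have h4 : m < 1 := by exact_mod_cast h2
  omega

theorem endpoints_le_of_oArc_subset {a b c d y : ℝ} (hcd : d ≤ c + 1)
    (hy : y ∈ Ioo a b) (hy' : y ∈ Ioo c d) (h : oArc a b ⊆ oArc c d) : c ≤ a ∧ b ≤ d := by
  constructor
  · by_contra! hac
    exact tc_left_notMem_oArc hcd (h ⟨c, ⟨hac, hy'.1.trans hy.2⟩, rfl⟩)
  · by_contra! hdb
    exact tc_right_notMem_oArc hcd (h ⟨d, ⟨hy.1.trans hy'.2, hdb⟩, rfl⟩)

theorem oArc_add_intCast (a b : ℝ) (m : ℤ) : oArc (a + m) (b + m) = oArc a b := by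
  rw [oArc, oArc, ← image_add_const_Ioo, image_image]
  exact image_congr fun x _ => (tc_eq_tc_iff.2 ⟨m, rfl⟩).symm

theorem exists_int_of_oArc_eq {a b c d : ℝ} (hab : a < b) (hab' : b ≤ a + 1)
    (hcd : d ≤ c + 1) (h : oArc a b = oArc c d) : ∃ m : ℤ, a = c + m ∧ b = d + m := by
  obtain ⟨z, hz, hzy⟩ : tc ((a + b) / 2) ∈ oArc c d :=
    h ▸ ⟨_, ⟨by linarith, by linarith⟩, rfl⟩
  obtain ⟨m, hm⟩ := tc_eq_tc_iff.1 hzy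
  have hy : (a + b) / 2 ∈ Ioo a b := ⟨by linarith, by linarith⟩
  have hy' : (a + b) / 2 ∈ Ioo (c + m) (d + m) := ⟨by linarith [hz.1], by linarith [hz.2]⟩
  rw [← oArc_add_intCast c d m] at h
  have h1 := endpoints_le_of_oArc_subset (by linarith) hy hy' h.subset
  have h2 := endpoints_le_of_oArc_subset hab' hy' hy h.symm.subset
  exact ⟨m, le_antisymm h2.1 h1.1, le_antisymm h1.2 h2.2⟩

theorem image_sigmaC_iterate_oArc (a b : ℝ) (n : ℕ) :
    (sigmaC 3)^[n] '' oArc a b = oArc (3 ^ n * a) (3 ^ n * b) := by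
  rw [oArc, oArc, ← image_mul_left_Ioo (by positivity : (0 : ℝ) < 3 ^ n), image_image,
    image_image]
  exact image_congr fun x _ => by simpa using sigmaC_iterate_tc 3 n x

theorem pow_mul_sub_le_one_of_injOn {a b : ℝ} {n : ℕ} (hab : b ≤ a + 1)
    (h : InjOn (sigmaC 3)^[n] (oArc a b)) : (3 : ℝ) ^ n * b ≤ 3 ^ n * a + 1 := by
  by_contra! hlt
  have hpos : (0 : ℝ) < 3 ^ n := by positivity
  have hδ : (0 : ℝ) < 1 / 3 ^ n := by positivity
  have hδ' : (3 : ℝ) ^ n * (1 / 3 ^ n) = 1 := by field_simp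
  have hgap : a + 1 / 3 ^ n < b := by
    refine lt_of_mul_lt_mul_left ?_ hpos.le
    rw [mul_add, hδ']
    exact hlt
  set x := (a + (b - 1 / 3 ^ n)) / 2 with hx
  have hx₁ : x ∈ Ioo a b := ⟨by linarith, by linarith⟩
  have hx₂ : x + 1 / 3 ^ n ∈ Ioo a b := ⟨by linarith, by linarith⟩
  have heq := h ⟨x, hx₁, rfl⟩ ⟨_, hx₂, rfl⟩ (by
    rw [sigmaC_iterate_tc, sigmaC_iterate_tc, tc_eq_tc_iff]
    refine ⟨1, ?_⟩
    push_cast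
    rw [mul_add, hδ'])
  linarith [tc_injOn_Ioo hab hx₁ hx₂ heq]

theorem rTypes_bounds {J : ℝ × ℝ} (hJ : J ∈ rTypes) : J.1 < J.2 ∧ J.2 ≤ J.1 + 1 := by
  rcases hJ with rfl | rfl | rfl <;> norm_num

/-- R-intervals are the preimages of integer translates of the model arcs under the
expansions `x ↦ 3 ^ n * x` of the line. -/
theorem isRInterval_iff {a b : ℝ} :
    IsRInterval a b ↔
      ∃ J ∈ rTypes, ∃ (n : ℕ) (m : ℤ), 3 ^ n * a = J.1 + m ∧ 3 ^ n * b = J.2 + m := by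
  constructor
  · rintro ⟨J, n, hab, hab', hJ, e, he⟩
    have hinj : InjOn (sigmaC 3)^[n] (oArc a b) := fun x hx y hy hxy => by
      have : e ⟨x, hx⟩ = e ⟨y, hy⟩ := Subtype.ext (by rw [he, he]; exact hxy)
      exact congrArg Subtype.val (e.injective this)
    have himg : (sigmaC 3)^[n] '' oArc a b = oArc J.1 J.2 := by
      ext z
      constructor
      · rintro ⟨x, hx, rfl⟩
        exact he ⟨x, hx⟩ ▸ (e ⟨x, hx⟩).2
      · intro hz
        exact ⟨e.symm ⟨z, hz⟩, (e.symm ⟨z, hz⟩).2, by rw [← he, e.apply_symm_apply]⟩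
    rw [image_sigmaC_iterate_oArc] at himg
    obtain ⟨m, hm⟩ := exists_int_of_oArc_eq (by gcongr) (pow_mul_sub_le_one_of_injOn hab' hinj)
      (rTypes_bounds hJ).2 himg
    exact ⟨J, hJ, n, m, hm⟩
  · rintro ⟨J, hJ, n, m, ha, hb⟩
    obtain ⟨hJ₁, hJ₂⟩ := rTypes_bounds hJ
    have hpos : (0 : ℝ) < 3 ^ n := by positivity
    have hone : (1 : ℝ) ≤ 3 ^ n := one_le_pow₀ (by norm_num)
    have hab : a < b := lt_of_mul_lt_mul_left (by linarith) hpos.le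
    have hab' : b ≤ a + 1 := le_of_mul_le_mul_left (by linarith) hpos
    have hmap : (fun x : ℝ => 3 ^ n * x + -(m : ℝ)) '' Ioo a b = Ioo J.1 J.2 := by
      rw [image_affine_Ioo hpos, ha, hb, add_neg_cancel_right, add_neg_cancel_right]
    let f : Ioo a b ≃ₜ Ioo J.1 J.2 :=
      ((affineHomeomorph ((3 : ℝ) ^ n) (-(m : ℝ)) hpos.ne').image (Ioo a b)).trans
        (Homeomorph.setCongr hmap)
    refine ⟨J, n, hab, hab', hJ,
      (oArcHomeomorph hab').symm.trans (f.trans (oArcHomeomorph hJ₂)), fun x => ?_⟩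
    obtain ⟨y, rfl⟩ := (oArcHomeomorph hab').surjective x
    simp only [Homeomorph.trans_apply, Homeomorph.symm_apply_apply, coe_oArcHomeomorph,
      sigmaC_iterate_tc]
    refine tc_eq_tc_iff.2 ⟨m, ?_⟩
    change _ = 3 ^ n * (y : ℝ) + -(m : ℝ) + m
    push_cast
    ring

theorem isRInterval_typeA {a b : ℝ} (n : ℕ) (m : ℤ) (ha : 3 ^ n * a = m)
    (hb : 3 ^ n * b = m + 1) : IsRInterval a b :=
  isRInterval_iff.2 ⟨(0, 1), by simp [rTypes], n, m, by simp [ha], by simp [hb, add_comm]⟩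

theorem isRInterval_typeB {a b : ℝ} (n : ℕ) (m : ℤ) (ha : 3 ^ n * a = m)
    (hb : 3 ^ n * b = m + 2 / 3) : IsRInterval a b :=
  isRInterval_iff.2 ⟨(0, 2 / 3), by simp [rTypes], n, m, by simp [ha], by simp [hb, add_comm]⟩

theorem isRInterval_typeC {a b : ℝ} (n : ℕ) (m : ℤ) (ha : 3 ^ n * a = m + 1 / 3)
    (hb : 3 ^ n * b = m + 1) : IsRInterval a b :=
  isRInterval_iff.2 ⟨(1 / 3, 1), by simp [rTypes], n, m, by simp [ha, add_comm],
    by simp [hb, add_comm]⟩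

theorem redT_tc {x : ℝ} (k : ℕ) (m : ℤ) (h : 3 ^ (k + 1) * x = 3 * m + 1) : RedT (tc x) := by
  refine ⟨3 * m + 1, k + 1, by omega, by omega, congrArg tc ?_⟩
  rw [eq_div_iff (by positivity), mul_comm, h]
  push_cast
  ring

theorem blueT_tc {x : ℝ} (k : ℕ) (m : ℤ) (h : 3 ^ (k + 1) * x = 3 * m + 2) : BlueT (tc x) := by
  refine Or.inr ⟨3 * m + 2, k + 1, by omega, by omega, congrArg tc ?_⟩
  rw [eq_div_iff (by positivity), mul_comm, h]
  push_cast
  ring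

theorem exists_red_blue_decomposition {a b : ℝ} (h : IsRInterval a b) :
    ∃ x₁ x₂ : ℝ, a < x₁ ∧ x₁ < x₂ ∧ x₂ < b ∧
      IsRInterval a x₁ ∧ IsRInterval x₁ x₂ ∧ IsRInterval x₂ b ∧
      RedT (tc x₁) ∧ BlueT (tc x₂) := by
  obtain ⟨J, hJ, n, m, ha, hb⟩ := isRInterval_iff.1 h
  have hpos : (0 : ℝ) < 3 ^ n := by positivity
  have hlift (t : ℝ) : (3 : ℝ) ^ n * (t / 3 ^ n) = t := by field_simp
  rcases hJ with rfl | rfl | rfl <;> dsimp only at ha hb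
  · obtain ⟨x, hx⟩ : ∃ x : ℝ, 3 ^ n * x = m + 1 / 3 := ⟨_, hlift _⟩
    obtain ⟨y, hy⟩ : ∃ y : ℝ, 3 ^ n * y = m + 2 / 3 := ⟨_, hlift _⟩
    refine ⟨x, y, ?_, ?_, ?_, isRInterval_typeA (n + 1) (3 * m) ?_ ?_,
      isRInterval_typeA (n + 1) (3 * m + 1) ?_ ?_, isRInterval_typeA (n + 1) (3 * m + 2) ?_ ?_,
      redT_tc n m ?_, blueT_tc n m ?_⟩
    any_goals refine lt_of_mul_lt_mul_left ?_ hpos.le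
    all_goals push_cast [pow_succ]; linarith
  · obtain ⟨x, hx⟩ : ∃ x : ℝ, 3 ^ n * x = m + 1 / 3 := ⟨_, hlift _⟩
    obtain ⟨y, hy⟩ : ∃ y : ℝ, 3 ^ n * y = m + 5 / 9 := ⟨_, hlift _⟩
    refine ⟨x, y, ?_, ?_, ?_, isRInterval_typeA (n + 1) (3 * m) ?_ ?_,
      isRInterval_typeB (n + 1) (3 * m + 1) ?_ ?_, isRInterval_typeA (n + 2) (9 * m + 5) ?_ ?_,
      redT_tc n m ?_, blueT_tc (n + 1) (3 * m + 1) ?_⟩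
    any_goals refine lt_of_mul_lt_mul_left ?_ hpos.le
    all_goals push_cast [pow_succ]; linarith
  · obtain ⟨x, hx⟩ : ∃ x : ℝ, 3 ^ n * x = m + 4 / 9 := ⟨_, hlift _⟩
    obtain ⟨y, hy⟩ : ∃ y : ℝ, 3 ^ n * y = m + 2 / 3 := ⟨_, hlift _⟩
    refine ⟨x, y, ?_, ?_, ?_, isRInterval_typeA (n + 2) (9 * m + 3) ?_ ?_,
      isRInterval_typeC (n + 1) (3 * m + 1) ?_ ?_, isRInterval_typeA (n + 1) (3 * m + 2) ?_ ?_,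
      redT_tc (n + 1) (3 * m + 1) ?_, blueT_tc n m ?_⟩
    any_goals refine lt_of_mul_lt_mul_left ?_ hpos.le
    all_goals push_cast [pow_succ]; linarith

theorem exists_blue_red_decomposition {a b : ℝ} (h : IsRInterval a b) :
    ∃ x₁ x₂ : ℝ, a < x₁ ∧ x₁ < x₂ ∧ x₂ < b ∧
      IsRInterval a x₁ ∧ IsRInterval x₁ x₂ ∧ IsRInterval x₂ b ∧
      BlueT (tc x₁) ∧ RedT (tc x₂) := by
  obtain ⟨J, hJ, n, m, ha, hb⟩ := isRInterval_iff.1 h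
  have hpos : (0 : ℝ) < 3 ^ n := by positivity
  have hlift (t : ℝ) : (3 : ℝ) ^ n * (t / 3 ^ n) = t := by field_simp
  rcases hJ with rfl | rfl | rfl <;> dsimp only at ha hb
  · obtain ⟨x, hx⟩ : ∃ x : ℝ, 3 ^ n * x = m + 2 / 3 := ⟨_, hlift _⟩
    obtain ⟨y, hy⟩ : ∃ y : ℝ, 3 ^ n * y = m + 7 / 9 := ⟨_, hlift _⟩
    refine ⟨x, y, ?_, ?_, ?_, isRInterval_typeB n m ?_ ?_,
      isRInterval_typeA (n + 2) (9 * m + 6) ?_ ?_, isRInterval_typeC (n + 1) (3 * m + 2) ?_ ?_,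
      blueT_tc n m ?_, redT_tc (n + 1) (3 * m + 2) ?_⟩
    any_goals refine lt_of_mul_lt_mul_left ?_ hpos.le
    all_goals push_cast [pow_succ]; linarith
  · obtain ⟨x, hx⟩ : ∃ x : ℝ, 3 ^ n * x = m + 2 / 9 := ⟨_, hlift _⟩
    obtain ⟨y, hy⟩ : ∃ y : ℝ, 3 ^ n * y = m + 1 / 3 := ⟨_, hlift _⟩
    refine ⟨x, y, ?_, ?_, ?_, isRInterval_typeB (n + 1) (3 * m) ?_ ?_,
      isRInterval_typeA (n + 2) (9 * m + 2) ?_ ?_, isRInterval_typeA (n + 1) (3 * m + 1) ?_ ?_,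
      blueT_tc (n + 1) (3 * m) ?_, redT_tc n m ?_⟩
    any_goals refine lt_of_mul_lt_mul_left ?_ hpos.le
    all_goals push_cast [pow_succ]; linarith
  · obtain ⟨x, hx⟩ : ∃ x : ℝ, 3 ^ n * x = m + 2 / 3 := ⟨_, hlift _⟩
    obtain ⟨y, hy⟩ : ∃ y : ℝ, 3 ^ n * y = m + 7 / 9 := ⟨_, hlift _⟩
    refine ⟨x, y, ?_, ?_, ?_, isRInterval_typeA (n + 1) (3 * m + 1) ?_ ?_,
      isRInterval_typeA (n + 2) (9 * m + 6) ?_ ?_, isRInterval_typeC (n + 1) (3 * m + 2) ?_ ?_,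
      blueT_tc n m ?_, redT_tc (n + 1) (3 * m + 2) ?_⟩
    any_goals refine lt_of_mul_lt_mul_left ?_ hpos.le
    all_goals push_cast [pow_succ]; linarith

/-- Let `I = [s,t]` be an R-interval and let `(c₁, c₂)` be an ordering of the two colors.
Then there are points `x₁, x₂` with `s, x₁, x₂, t` in positive order along `I` such that
`[s,x₁]`, `[x₁,x₂]`, `[x₂,t]` are R-intervals whose union is `I`, and `x_i` has color `c_i`
for `i = 1, 2`. -/
theorem rInterval_two_point_decomposition (a b : ℝ) (h : IsRInterval a b)
    (c₁ c₂ : TColor) (hc : c₁ ≠ c₂) :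
    ∃ x₁ x₂ : ℝ, a < x₁ ∧ x₁ < x₂ ∧ x₂ < b ∧
      IsRInterval a x₁ ∧ IsRInterval x₁ x₂ ∧ IsRInterval x₂ b ∧
      HasTColor c₁ (tc x₁) ∧ HasTColor c₂ (tc x₂) := by
  match c₁, c₂, hc with
  | TColor.red, TColor.blue, _ => exact exists_red_blue_decomposition h
  | TColor.blue, TColor.red, _ => exact exists_blue_red_decomposition h
  | TColor.red, TColor.red, hc => exact absurd rfl hc
  | TColor.blue, TColor.blue, hc => exact absurd rfl hc
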